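/- For every natural number n there exist integers k < l (both ≥ 1) such that every TL_n formula defines trivial truth sets of the same type in M_k and in M_l: for each TL_n formula φ, its truth set in M_k is one of ∅, ℝ, P_k, ℝ∖P_k, its truth set in M_l is one of ∅, ℝ, P_l, ℝ∖P_l, and the two are of the same type (∅ corresponds to ∅, ℝ to ℝ, P_k to P_l, and ℝ∖P_k to ℝ∖P_l). -/

import Mathlib

/-- Formulas of second-order monadic logic of order `L` over the signature `<`, `B`, `P`,
in de Bruijn style: `Fml m n` has first-order variables `Fin m` and monadic second-order
variables `Fin n`. -/
inductive Fml : ℕ → ℕ → Type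
  | eq {m n : ℕ} (i j : Fin m) : Fml m n
  | lt {m n : ℕ} (i j : Fin m) : Fml m n
  | B {m n : ℕ} (i j : Fin m) : Fml m n
  | P {m n : ℕ} (i : Fin m) : Fml m n
  | X {m n : ℕ} (x : Fin n) (i : Fin m) : Fml m n
  | not {m n : ℕ} (φ : Fml m n) : Fml m n
  | and {m n : ℕ} (φ ψ : Fml m n) : Fml m n
  | exFO {m n : ℕ} (φ : Fml (m + 1) n) : Fml m n
  | exSO {m n : ℕ} (φ : Fml m (n + 1)) : Fml m n

/-- Satisfaction of an `L`-formula in a structure with domain `D`, order `lo`,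
binary relation `Bo` and unary predicate `Pred`, under assignments `v` (first-order)
and `w` (second-order). -/
def Fml.Sat {D : Type} (lo Bo : D → D → Prop) (Pred : Set D) :
    ∀ {m n : ℕ}, Fml m n → (Fin m → D) → (Fin n → Set D) → Prop
  | _, _, .eq i j, v, _ => v i = v j
  | _, _, .lt i j, v, _ => lo (v i) (v j)
  | _, _, .B i j, v, _ => Bo (v i) (v j)
  | _, _, .P i, v, _ => v i ∈ Pred
  | _, _, .X x i, v, w => v i ∈ w x
  | _, _, .not φ, v, w => ¬ Fml.Sat lo Bo Pred φ v w
  | _, _, .and φ ψ, v, w => Fml.Sat lo Bo Pred φ v w ∧ Fml.Sat lo Bo Pred ψ v w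
  | _, _, .exFO φ, v, w => ∃ d : D, Fml.Sat lo Bo Pred φ (Fin.cons d v) w
  | _, _, .exSO φ, v, w => ∃ A : Set D, Fml.Sat lo Bo Pred φ v (Fin.cons A w)

/-- Quantifier depth (counting both first- and second-order quantifiers). -/
def Fml.qd : ∀ {m n : ℕ}, Fml m n → ℕ
  | _, _, .eq _ _ => 0
  | _, _, .lt _ _ => 0
  | _, _, .B _ _ => 0
  | _, _, .P _ => 0
  | _, _, .X _ _ => 0
  | _, _, .not φ => φ.qd
  | _, _, .and φ ψ => max φ.qd ψ.qd
  | _, _, .exFO φ => φ.qd + 1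
  | _, _, .exSO φ => φ.qd + 1

/-- Satisfaction over the real line: `<` is the usual order and `B(t,s) ↔ s = t + 1`. -/
def Fml.SatR (Pred : Set ℝ) {m n : ℕ} (φ : Fml m n)
    (v : Fin m → ℝ) (w : Fin n → Set ℝ) : Prop :=
  Fml.Sat (· < ·) (fun t s => s = t + 1) Pred φ v w

/-- The set `P_k = {m/k : m ∈ ℤ}`, the interpretation of `P` in the model `M_k`. -/
def Pk (k : ℕ) : Set ℝ := {x : ℝ | ∃ m : ℤ, x = m / k}

/-- Formulas of the temporal logic `TL_n`: built from the atom `p` and `⊤` by Boolean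
connectives and applications of modalities whose truth tables are `L`-formulas with one
free first-order variable, `j` free monadic variables, and quantifier depth at most `n`. -/
inductive TL (n : ℕ) : Type
  | top : TL n
  | atom : TL n
  | not : TL n → TL n
  | and : TL n → TL n → TL n
  | mod : (j : ℕ) → (O : Fml 1 j) → O.qd ≤ n → (Fin j → TL n) → TL n

/-- The truth set of a `TL_n` formula in the structure `(ℝ, <, B, P)` with `P`
interpreted as `Pred`. -/
def TL.truth {n : ℕ} (Pred : Set ℝ) : TL n → Set ℝ
  | .top => Set.univ
  | .atom => Pred
  | .not φ => (TL.truth Pred φ)ᶜ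
  | .and φ ψ => TL.truth Pred φ ∩ TL.truth Pred ψ
  | .mod _ O _ args =>
      {t : ℝ | Fml.SatR Pred O (fun _ => t) (fun i => TL.truth Pred (args i))}

/-- The four trivial predicate types: `True`, `False`, `P`, `¬P`. -/
inductive Triv : Type
  | tt : Triv
  | ff : Triv
  | pp : Triv
  | np : Triv

/-- Interpretation of a trivial predicate type in a model whose interpretation of `P`
is `Pred`. -/
def Triv.interp (Pred : Set ℝ) : Triv → Set ℝ
  | .tt => Set.univ
  | .ff => ∅
  | .pp => Pred
  | .np => Predᶜ

/-- Rank-`r` Ehrenfeucht–Fraïssé types of `m` elements and `s` subsets. -/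
def RankType : ℕ → ℕ → ℕ → Type
  | 0, m, s => (Fin m → Fin m → Prop) × (Fin m → Fin m → Prop) × (Fin m → Fin m → Prop) ×
      (Fin m → Prop) × (Fin s → Fin m → Prop)
  | r + 1, m, s => RankType r m s × Set (RankType r (m + 1) s) × Set (RankType r m (s + 1))

instance RankType.finite : ∀ r m s : ℕ, Finite (RankType r m s)
  | 0, _, _ => by unfold RankType; infer_instance
  | r + 1, m, s => by
    have := RankType.finite r m s
    have := RankType.finite r (m + 1) s
    have := RankType.finite r m (s + 1)
    unfold RankType
    infer_instance

/-- The rank-`r` type realised by a tuple of reals and a tuple of sets of reals. -/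
def rankType (Pred : Set ℝ) :
    ∀ r {m s : ℕ}, (Fin m → ℝ) → (Fin s → Set ℝ) → RankType r m s
  | 0, _, _, v, w => (fun i j => v i = v j, fun i j => v i < v j, fun i j => v j = v i + 1,
      fun i => v i ∈ Pred, fun x i => v i ∈ w x)
  | r + 1, _, _, v, w => (rankType Pred r v w,
      Set.range fun d : ℝ => rankType Pred r (Fin.cons d v : Fin _ → ℝ) w,
      Set.range fun A : Set ℝ => rankType Pred r v (Fin.cons A w : Fin _ → Set ℝ))

lemma rankType_zero_eq {Q R : Set ℝ} {r m s : ℕ} {v v' : Fin m → ℝ} {w w' : Fin s → Set ℝ}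
    (h : rankType Q r v w = rankType R r v' w') : rankType Q 0 v w = rankType R 0 v' w' := by
  induction r with
  | zero => exact h
  | succ r ih => exact ih (Prod.ext_iff.mp h).1

lemma cons_comp_cons_zero {α : Type*} {n s : ℕ} (A : α) (w : Fin s → α) (g : Fin n → Fin s) :
    (Fin.cons A (fun i => w (g i)) : Fin (n + 1) → α) =
      fun i => (Fin.cons A w : Fin (s + 1) → α)
        ((Fin.cons 0 (fun i => (g i).succ) : Fin (n + 1) → Fin (s + 1)) i) := by
  funext i
  refine Fin.cases ?_ (fun i => ?_) i <;> simp

/-- Equal rank-`r` types satisfy the same formulas of quantifier depth at most `r`, also after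
pulling the set variables back along a map of indices. -/
lemma satR_iff_of_rankType_eq {Q R : Set ℝ} {m n : ℕ} (φ : Fml m n) :
    ∀ {r s : ℕ} {v v' : Fin m → ℝ} {w w' : Fin s → Set ℝ} (g : Fin n → Fin s), φ.qd ≤ r →
      rankType Q r v w = rankType R r v' w' →
      (φ.SatR Q v (fun i => w (g i)) ↔ φ.SatR R v' (fun i => w' (g i))) := by
  unfold Fml.SatR
  induction φ with
  | eq i j =>
    intro r s v v' w w' g _ h
    exact iff_of_eq (congrFun (congrFun (congrArg (·.1) (rankType_zero_eq h)) i) j)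
  | lt i j =>
    intro r s v v' w w' g _ h
    exact iff_of_eq (congrFun (congrFun (congrArg (·.2.1) (rankType_zero_eq h)) i) j)
  | B i j =>
    intro r s v v' w w' g _ h
    exact iff_of_eq (congrFun (congrFun (congrArg (·.2.2.1) (rankType_zero_eq h)) i) j)
  | P i =>
    intro r s v v' w w' g _ h
    exact iff_of_eq (congrFun (congrArg (·.2.2.2.1) (rankType_zero_eq h)) i)
  | X x i =>
    intro r s v v' w w' g _ h
    exact iff_of_eq (congrFun (congrFun (congrArg (·.2.2.2.2) (rankType_zero_eq h)) (g x)) i)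
  | not φ ih =>
    intro r s v v' w w' g hq h
    exact not_congr (ih g hq h)
  | and φ ψ ih₁ ih₂ =>
    intro r s v v' w w' g hq h
    exact and_congr (ih₁ g ((le_max_left _ _).trans hq) h) (ih₂ g ((le_max_right _ _).trans hq) h)
  | exFO φ ih =>
    intro r s v v' w w' g hq h
    obtain _ | r := r
    · exact absurd hq (Nat.not_succ_le_zero _)
    have hq' : φ.qd ≤ r := Nat.le_of_succ_le_succ hq
    have hr := congrArg (·.2.1) h
    simp only [rankType] at hr
    constructor
    · rintro ⟨d, hd⟩
      obtain ⟨d', hd'⟩ := hr.le ⟨d, rfl⟩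
      exact ⟨d', (ih g hq' hd'.symm).mp hd⟩
    · rintro ⟨d, hd⟩
      obtain ⟨d', hd'⟩ := hr.ge ⟨d, rfl⟩
      exact ⟨d', (ih g hq' hd').mpr hd⟩
  | exSO φ ih =>
    intro r s v v' w w' g hq h
    obtain _ | r := r
    · exact absurd hq (Nat.not_succ_le_zero _)
    have hq' : φ.qd ≤ r := Nat.le_of_succ_le_succ hq
    have hr := congrArg (·.2.2) h
    simp only [rankType] at hr
    simp only [Fml.Sat, fun (A : Set ℝ) w => cons_comp_cons_zero A w g]
    constructor
    · rintro ⟨d, hd⟩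
      obtain ⟨d', hd'⟩ := hr.le ⟨d, rfl⟩
      exact ⟨d', (ih _ hq' hd'.symm).mp hd⟩
    · rintro ⟨d, hd⟩
      obtain ⟨d', hd'⟩ := hr.ge ⟨d, rfl⟩
      exact ⟨d', (ih _ hq' hd').mpr hd⟩

/-- Satisfaction is invariant under automorphisms of the structure. -/
lemma satR_automorphism {Q : Set ℝ} (σ : ℝ ≃o ℝ) (hs : ∀ x, σ (x + 1) = σ x + 1)
    (hQ : ∀ x, σ x ∈ Q ↔ x ∈ Q) {m n : ℕ} (φ : Fml m n) :
    ∀ (v : Fin m → ℝ) (w : Fin n → Set ℝ),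
      φ.SatR Q v (fun i => σ ⁻¹' w i) ↔ φ.SatR Q (fun i => σ (v i)) w := by
  unfold Fml.SatR
  induction φ with
  | eq i j => exact fun v w => (σ.injective.eq_iff).symm
  | lt i j => exact fun v w => (σ.lt_iff_lt).symm
  | B i j =>
    intro v w
    simp only [Fml.Sat, ← hs, σ.injective.eq_iff]
  | P i => exact fun v w => (hQ _).symm
  | X x i => exact fun v w => Iff.rfl
  | not φ ih => exact fun v w => not_congr (ih v w)
  | and φ ψ ih₁ ih₂ => exact fun v w => and_congr (ih₁ v w) (ih₂ v w)
  | @exFO m n φ ih =>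
    intro v w
    have hc (d : ℝ) : (Fin.cons (σ d) (fun i => σ (v i)) : Fin (m + 1) → ℝ) =
        fun i => σ ((Fin.cons d v : Fin (m + 1) → ℝ) i) := by
      funext i
      refine Fin.cases ?_ (fun i => ?_) i <;> simp
    refine (exists_congr fun d => ?_).trans σ.surjective.exists.symm
    rw [hc]
    exact ih _ _
  | @exSO m n φ ih =>
    intro v w
    have hc (A : Set ℝ) : (Fin.cons (σ ⁻¹' A) (fun i => σ ⁻¹' w i) : Fin (n + 1) → Set ℝ) =
        fun i => σ ⁻¹' (Fin.cons A w : Fin (n + 1) → Set ℝ) i := by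
      funext i
      refine Fin.cases ?_ (fun i => ?_) i <;> simp
    simp only [Fml.Sat]
    rw [(Set.preimage_surjective.mpr σ.injective).exists]
    simp only [hc, ih]

/-- The map of `[0, 1)` multiplying the odds `t / (1 - t)` by `c`. -/
noncomputable def oddsScale (c t : ℝ) : ℝ := c * t / (1 + (c - 1) * t)

lemma oddsScale_denom_pos {c t : ℝ} (hc : 0 < c) (h0 : 0 ≤ t) (h1 : t < 1) :
    0 < 1 + (c - 1) * t := by
  nlinarith [mul_nonneg hc.le h0]

lemma oddsScale_nonneg {c t : ℝ} (hc : 0 < c) (h0 : 0 ≤ t) (h1 : t < 1) :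
    0 ≤ oddsScale c t :=
  div_nonneg (mul_nonneg hc.le h0) (oddsScale_denom_pos hc h0 h1).le

lemma oddsScale_lt_one {c t : ℝ} (hc : 0 < c) (h0 : 0 ≤ t) (h1 : t < 1) :
    oddsScale c t < 1 := by
  rw [oddsScale, div_lt_one (oddsScale_denom_pos hc h0 h1)]
  linarith

lemma oddsScale_lt {c s t : ℝ} (hc : 0 < c) (h0 : 0 ≤ s) (hst : s < t) (h1 : t < 1) :
    oddsScale c s < oddsScale c t := by
  rw [oddsScale, oddsScale, div_lt_div_iff₀ (oddsScale_denom_pos hc h0 (hst.trans h1))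
    (oddsScale_denom_pos hc (h0.trans hst.le) h1)]
  nlinarith [mul_pos hc (sub_pos.mpr hst)]

lemma oddsScale_inv {c t : ℝ} (hc : 0 < c) (h0 : 0 ≤ t) (h1 : t < 1) :
    oddsScale c (oddsScale c⁻¹ t) = t := by
  have hd := oddsScale_denom_pos (inv_pos.mpr hc) h0 h1
  have hd' := oddsScale_denom_pos hc (oddsScale_nonneg (inv_pos.mpr hc) h0 h1)
    (oddsScale_lt_one (inv_pos.mpr hc) h0 h1)
  have hm : oddsScale c⁻¹ t * (1 + (c⁻¹ - 1) * t) = c⁻¹ * t := div_mul_cancel₀ _ hd.ne'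
  rw [oddsScale, div_eq_iff hd'.ne']
  refine mul_right_cancel₀ hd.ne' ?_
  have hcc : c * c⁻¹ = 1 := mul_inv_cancel₀ hc.ne'
  linear_combination (c - (c - 1) * t) * hm + (t - t ^ 2) * hcc

/-- Applying `oddsScale c` to the fractional part. -/
noncomputable def fractScale (c z : ℝ) : ℝ := ⌊z⌋ + oddsScale c (Int.fract z)

lemma floor_fractScale {c : ℝ} (hc : 0 < c) (z : ℝ) : ⌊fractScale c z⌋ = ⌊z⌋ := by
  have h0 := Int.fract_nonneg z
  have h1 := Int.fract_lt_one z
  rw [Int.floor_eq_iff, fractScale]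
  exact ⟨by linarith [oddsScale_nonneg hc h0 h1], by linarith [oddsScale_lt_one hc h0 h1]⟩

lemma fract_fractScale {c : ℝ} (hc : 0 < c) (z : ℝ) :
    Int.fract (fractScale c z) = oddsScale c (Int.fract z) := by
  rw [Int.fract, floor_fractScale hc, fractScale, add_sub_cancel_left]

lemma fractScale_strictMono {c : ℝ} (hc : 0 < c) : StrictMono (fractScale c) := by
  intro x y hxy
  rcases (Int.floor_le_floor hxy.le).lt_or_eq with h | h
  · by_contra! hle
    have := Int.floor_le_floor hle
    rw [floor_fractScale hc, floor_fractScale hc] at this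
    omega
  · have hf : Int.fract x < Int.fract y := by
      rw [Int.fract, Int.fract, h]
      linarith
    rw [fractScale, fractScale, h]
    linarith [oddsScale_lt hc (Int.fract_nonneg x) hf (Int.fract_lt_one y)]

lemma fractScale_surjective {c : ℝ} (hc : 0 < c) : Function.Surjective (fractScale c) := by
  intro z
  refine ⟨fractScale c⁻¹ z, ?_⟩
  rw [fractScale, fract_fractScale (inv_pos.mpr hc), floor_fractScale (inv_pos.mpr hc),
    oddsScale_inv hc (Int.fract_nonneg z) (Int.fract_lt_one z), Int.floor_add_fract]

lemma fractScale_add_int (c z : ℝ) (m : ℤ) : fractScale c (z + m) = fractScale c z + m := by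
  simp only [fractScale, Int.floor_add_intCast, Int.fract_add_intCast, Int.cast_add]
  ring

lemma fractScale_intCast (c : ℝ) (m : ℤ) : fractScale c m = m := by
  simp [fractScale, oddsScale]

lemma mem_Pk_iff {k : ℕ} (hk : 1 ≤ k) (x : ℝ) : x ∈ Pk k ↔ ∃ m : ℤ, (m : ℝ) = k * x := by
  have : (0 : ℝ) < k := by exact_mod_cast hk
  refine exists_congr fun m => ?_
  rw [eq_div_iff this.ne', eq_comm, mul_comm]

/-- The automorphism of `M_k` given by `fractScale c`, rescaled by `k` and shifted by `m / k`. -/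
lemma exists_automorphism_Pk {k : ℕ} (hk : 1 ≤ k) {c : ℝ} (hc : 0 < c) (m : ℤ) :
    ∃ σ : ℝ ≃o ℝ, (∀ x, σ (x + 1) = σ x + 1) ∧ (∀ x, σ x ∈ Pk k ↔ x ∈ Pk k) ∧
      ∀ x, σ x = (fractScale c (k * x) + m) / k := by
  have hk0 : (0 : ℝ) < k := by exact_mod_cast hk
  have hmono : StrictMono fun x : ℝ => (fractScale c (k * x) + m) / k := by
    intro x y hxy
    have := fractScale_strictMono hc (mul_lt_mul_of_pos_left hxy hk0)
    exact div_lt_div_of_pos_right (by linarith) hk0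
  have hsurj : Function.Surjective fun x : ℝ => (fractScale c (k * x) + m) / k := by
    intro z
    obtain ⟨y, hy⟩ := fractScale_surjective hc (k * z - m)
    refine ⟨y / k, ?_⟩
    simp only [mul_div_cancel₀ _ hk0.ne', hy]
    field_simp
    ring
  refine ⟨hmono.orderIsoOfSurjective _ hsurj, fun x => ?_, fun x => ?_, fun x => rfl⟩
  · have := fractScale_add_int c (k * x) k
    simp only [StrictMono.coe_orderIsoOfSurjective, mul_add, mul_one]
    push_cast at this
    rw [this]
    field_simp
    ring
  · simp only [StrictMono.coe_orderIsoOfSurjective, mem_Pk_iff hk, mul_div_cancel₀ _ hk0.ne']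
    constructor
    · rintro ⟨a, ha⟩
      refine ⟨a - m, (fractScale_strictMono hc).injective ?_⟩
      rw [fractScale_intCast]
      push_cast
      linarith
    · rintro ⟨a, ha⟩
      exact ⟨a + m, by rw [← ha, fractScale_intCast]; push_cast; rfl⟩

/-- The points of `Pk k` form one orbit of automorphisms, represented by `0`. -/
lemma exists_automorphism_of_mem {k : ℕ} (hk : 1 ≤ k) {x : ℝ} (hx : x ∈ Pk k) :
    ∃ σ : ℝ ≃o ℝ, (∀ x, σ (x + 1) = σ x + 1) ∧ (∀ x, σ x ∈ Pk k ↔ x ∈ Pk k) ∧ σ 0 = x := by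
  obtain ⟨m, rfl⟩ := hx
  obtain ⟨σ, h₁, h₂, h₃⟩ := exists_automorphism_Pk hk one_pos m
  refine ⟨σ, h₁, h₂, ?_⟩
  rw [h₃]
  simp [fractScale, oddsScale]

/-- The points outside `Pk k` form one orbit of automorphisms, represented by `1 / (2 k)`. -/
lemma exists_automorphism_of_notMem {k : ℕ} (hk : 1 ≤ k) {x : ℝ} (hx : x ∉ Pk k) :
    ∃ σ : ℝ ≃o ℝ, (∀ x, σ (x + 1) = σ x + 1) ∧ (∀ x, σ x ∈ Pk k ↔ x ∈ Pk k) ∧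
      σ (1 / (2 * k)) = x := by
  have hk0 : (0 : ℝ) < k := by exact_mod_cast hk
  have h1 := sub_pos.mpr (Int.fract_lt_one (k * x))
  have h0 : 0 < Int.fract (k * x) := by
    refine (Int.fract_nonneg _).lt_of_ne fun h => hx ((mem_Pk_iff hk x).mpr ⟨⌊k * x⌋, ?_⟩)
    linarith [Int.floor_add_fract ((k : ℝ) * x)]
  obtain ⟨σ, h₁, h₂, h₃⟩ := exists_automorphism_Pk hk (div_pos h0 h1) ⌊k * x⌋
  refine ⟨σ, h₁, h₂, ?_⟩
  have hh : (k : ℝ) * (1 / (2 * k)) = 1 / 2 := by field_simp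
  have hfl : ⌊(1 / 2 : ℝ)⌋ = 0 := by norm_num
  have hfr : Int.fract (1 / 2 : ℝ) = 1 / 2 := by rw [Int.fract, hfl]; simp
  have ho : oddsScale (Int.fract (k * x) / (1 - Int.fract (k * x))) (1 / 2) =
      Int.fract (k * x) := by
    rw [oddsScale, div_eq_iff (oddsScale_denom_pos (div_pos h0 h1) (by norm_num)
      (by norm_num)).ne']
    field_simp
    ring
  rw [h₃, hh, fractScale, hfl, hfr, ho, div_eq_iff hk0.ne']
  push_cast
  linarith [Int.floor_add_fract ((k : ℝ) * x)]

lemma Triv.preimage_interp {Q : Set ℝ} {σ : ℝ → ℝ} (hQ : ∀ x, σ x ∈ Q ↔ x ∈ Q) (τ : Triv) :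
    σ ⁻¹' τ.interp Q = τ.interp Q := by
  ext x
  cases τ <;> simp [Triv.interp, hQ]

/-- With trivial predicates as set parameters, satisfaction at `x` in `M_k` only depends on
whether `x ∈ Pk k`. -/
lemma satR_interp_iff {k j : ℕ} (hk : 1 ≤ k) (O : Fml 1 j) (τ : Fin j → Triv) (x : ℝ) :
    O.SatR (Pk k) (fun _ => x) (fun i => (τ i).interp (Pk k)) ↔
      (x ∈ Pk k ∧ O.SatR (Pk k) (fun _ => 0) (fun i => (τ i).interp (Pk k))) ∨
      (x ∉ Pk k ∧ O.SatR (Pk k) (fun _ => 1 / (2 * k)) (fun i => (τ i).interp (Pk k))) := by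
  by_cases hx : x ∈ Pk k
  · obtain ⟨σ, h₁, h₂, rfl⟩ := exists_automorphism_of_mem hk hx
    have := satR_automorphism σ h₁ h₂ O (fun _ => 0) (fun i => (τ i).interp (Pk k))
    simp only [Triv.preimage_interp h₂] at this
    simp [hx, this]
  · obtain ⟨σ, h₁, h₂, h₃⟩ := exists_automorphism_of_notMem hk hx
    have := satR_automorphism σ h₁ h₂ O (fun _ => 1 / (2 * k))
      (fun i => (τ i).interp (Pk k))
    simp only [Triv.preimage_interp h₂, h₃] at this
    simp only [hx, false_and, not_false_eq_true, true_and, false_or, this]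

lemma Triv.exists_interp (a b : Prop) :
    ∃ τ : Triv, ∀ Q : Set ℝ, {x | (x ∈ Q ∧ a) ∨ (x ∉ Q ∧ b)} = τ.interp Q := by
  by_cases ha : a <;> by_cases hb : b
  · exact ⟨.tt, fun Q => by ext; simp [Triv.interp, ha, hb, em]⟩
  · exact ⟨.pp, fun Q => by ext; simp [Triv.interp, ha, hb]⟩
  · exact ⟨.np, fun Q => by ext; simp [Triv.interp, ha, hb]⟩
  · exact ⟨.ff, fun Q => by ext; simp [Triv.interp, ha, hb]⟩

lemma Triv.exists_compl (τ : Triv) :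
    ∃ τ' : Triv, ∀ Q : Set ℝ, (τ.interp Q)ᶜ = τ'.interp Q := by
  cases τ
  exacts [⟨.ff, fun Q => by simp [Triv.interp]⟩, ⟨.tt, fun Q => by simp [Triv.interp]⟩,
    ⟨.np, fun Q => by simp [Triv.interp]⟩, ⟨.pp, fun Q => by simp [Triv.interp]⟩]

lemma Triv.exists_inter (τ₁ τ₂ : Triv) :
    ∃ τ : Triv, ∀ Q : Set ℝ, τ₁.interp Q ∩ τ₂.interp Q = τ.interp Q := by
  cases τ₁
  case tt => exact ⟨τ₂, fun Q => by simp [Triv.interp]⟩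
  case ff => exact ⟨.ff, fun Q => by simp [Triv.interp]⟩
  all_goals cases τ₂
  exacts [⟨.pp, fun Q => by simp [Triv.interp]⟩, ⟨.ff, fun Q => by simp [Triv.interp]⟩,
    ⟨.pp, fun Q => by simp [Triv.interp]⟩, ⟨.ff, fun Q => by simp [Triv.interp]⟩,
    ⟨.np, fun Q => by simp [Triv.interp]⟩, ⟨.ff, fun Q => by simp [Triv.interp]⟩,
    ⟨.ff, fun Q => by simp [Triv.interp]⟩, ⟨.np, fun Q => by simp [Triv.interp]⟩]

/-- An enumeration of the trivial predicate types. -/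
def Triv.enum : Fin 4 → Triv := ![.tt, .ff, .pp, .np]

lemma Triv.enum_surjective : Function.Surjective Triv.enum := by
  rintro (_ | _ | _ | _)
  exacts [⟨0, rfl⟩, ⟨1, rfl⟩, ⟨2, rfl⟩, ⟨3, rfl⟩]

/-- The rank-`n` type of `x`, with all trivial predicates as set parameters. -/
def trivRankType (n k : ℕ) (x : ℝ) : RankType n 1 4 :=
  rankType (Pk k) n (fun _ => x) (fun i => (Triv.enum i).interp (Pk k))

lemma TL.exists_common_triv {n k l : ℕ} (hk : 1 ≤ k) (hl : 1 ≤ l)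
    (h₀ : trivRankType n k 0 = trivRankType n l 0)
    (h₁ : trivRankType n k (1 / (2 * k)) = trivRankType n l (1 / (2 * l))) (φ : TL n) :
    ∃ τ : Triv, φ.truth (Pk k) = τ.interp (Pk k) ∧ φ.truth (Pk l) = τ.interp (Pk l) := by
  induction φ with
  | top => exact ⟨.tt, rfl, rfl⟩
  | atom => exact ⟨.pp, rfl, rfl⟩
  | not φ ih =>
    obtain ⟨τ, hτk, hτl⟩ := ih
    obtain ⟨τ', hτ'⟩ := τ.exists_compl
    exact ⟨τ', by rw [TL.truth, hτk, hτ'], by rw [TL.truth, hτl, hτ']⟩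
  | and φ ψ ih₁ ih₂ =>
    obtain ⟨τ₁, hτ₁k, hτ₁l⟩ := ih₁
    obtain ⟨τ₂, hτ₂k, hτ₂l⟩ := ih₂
    obtain ⟨τ, hτ⟩ := τ₁.exists_inter τ₂
    exact ⟨τ, by rw [TL.truth, hτ₁k, hτ₂k, hτ], by rw [TL.truth, hτ₁l, hτ₂l, hτ]⟩
  | mod j O hO args ih =>
    choose τ hτk hτl using ih
    choose g hg using fun i => Triv.enum_surjective (τ i)
    have e₀ := satR_iff_of_rankType_eq O g hO h₀
    have e₁ := satR_iff_of_rankType_eq O g hO h₁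
    simp only [hg] at e₀ e₁
    obtain ⟨τ', hτ'⟩ := Triv.exists_interp
      (O.SatR (Pk k) (fun _ => 0) (fun i => (τ i).interp (Pk k)))
      (O.SatR (Pk k) (fun _ => 1 / (2 * k)) (fun i => (τ i).interp (Pk k)))
    refine ⟨τ', ?_, ?_⟩
    · rw [← hτ']
      simp only [TL.truth, hτk]
      ext x
      exact satR_interp_iff hk O τ x
    · rw [← hτ', e₀, e₁]
      simp only [TL.truth, hτl]
      ext x
      exact satR_interp_iff hl O τ x

/-- For every `n` there are models `M_k` and `M_l` with `k < l` in which every `TL_n`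
formula defines trivial truth sets of the same type. -/
theorem exists_two_models_TLn_same_trivial (n : ℕ) :
    ∃ k l : ℕ, 1 ≤ k ∧ k < l ∧
      ∀ φ : TL n, ∃ τ : Triv,
        TL.truth (Pk k) φ = τ.interp (Pk k) ∧ TL.truth (Pk l) φ = τ.interp (Pk l) := by
  let f : ℕ → RankType n 1 4 × RankType n 1 4 := fun k =>
    (trivRankType n (k + 1) 0, trivRankType n (k + 1) (1 / (2 * (k + 1 : ℕ))))
  have key : ∃ a b, a < b ∧ f a = f b := by
    obtain ⟨a, b, hne, hf⟩ := Finite.exists_ne_map_eq_of_infinite f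
    rcases hne.lt_or_gt with h | h
    exacts [⟨a, b, h, hf⟩, ⟨b, a, h, hf.symm⟩]
  obtain ⟨a, b, hab, hf⟩ := key
  obtain ⟨h₀, h₁⟩ := Prod.ext_iff.mp hf
  exact ⟨a + 1, b + 1, Nat.le_add_left _ _, Nat.succ_lt_succ hab,
    TL.exists_common_triv (Nat.le_add_left _ _) (Nat.le_add_left _ _) h₀ h₁⟩
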